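/- Let μ₀ ∈ ℝ, σ₀ > 0 and τ_l < τ_u, let X be a random variable with the truncated normal distribution TN(μ₀,σ₀,τ_l,τ_u) and let F be its cumulative distribution function. Then ∫_{τ_l}^{τ_u} ∫_{τ_l}^{τ_u} (F(min(x,y)) − F(x)F(y)) dx dy = Var(X), where Var(X) = E[X²] − (E[X])². -/

import Mathlib

open Real

/-- The standard normal density `φ(x) = (1/√(2π)) e^{-x²/2}`. -/
noncomputable def stdPhi (x : ℝ) : ℝ := (Real.sqrt (2 * Real.pi))⁻¹ * Real.exp (-(x ^ 2) / 2)

/-- The standard normal cumulative distribution function `Φ`. -/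
noncomputable def stdPhiCDF (x : ℝ) : ℝ := ∫ t in Set.Iic x, stdPhi t

/-- The density of the truncated normal distribution `TN(μ,σ,τ_l,τ_u)` on `[τ_l, τ_u]`. -/
noncomputable def truncNormalPDF (μ σ τl τu : ℝ) (t : ℝ) : ℝ :=
  (1 / σ) * stdPhi ((t - μ) / σ) /
    (stdPhiCDF ((τu - μ) / σ) - stdPhiCDF ((τl - μ) / σ))

theorem continuous_stdPhi : Continuous stdPhi := by
  unfold stdPhi; fun_prop

theorem integrable_stdPhi : MeasureTheory.Integrable stdPhi := by
  have h := (integrable_exp_neg_mul_sq (b := 1 / 2) (by norm_num)).const_mul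
    (Real.sqrt (2 * Real.pi))⁻¹
  refine h.congr (Filter.Eventually.of_forall fun x => ?_)
  simp only [stdPhi]
  ring_nf

theorem stdPhi_pos (x : ℝ) : 0 < stdPhi x := by
  unfold stdPhi; positivity

theorem stdPhiCDF_sub (a b : ℝ) : stdPhiCDF b - stdPhiCDF a = ∫ t in a..b, stdPhi t :=
  intervalIntegral.integral_Iic_sub_Iic integrable_stdPhi.integrableOn integrable_stdPhi.integrableOn

theorem continuous_truncNormalPDF (μ σ a b : ℝ) : Continuous (truncNormalPDF μ σ a b) := by
  have := continuous_stdPhi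
  unfold truncNormalPDF
  simp only [div_eq_mul_inv]
  fun_prop

theorem integral_truncNormalPDF {μ σ a b : ℝ} (hσ : 0 < σ) (h : a < b) :
    ∫ t in a..b, truncNormalPDF μ σ a b t = 1 := by
  have hlt : (a - μ) / σ < (b - μ) / σ := by gcongr
  have hpos : 0 < ∫ t in (a - μ) / σ..(b - μ) / σ, stdPhi t :=
    intervalIntegral.intervalIntegral_pos_of_pos
      (continuous_stdPhi.intervalIntegrable _ _) stdPhi_pos hlt
  have hsub : ∫ t in a..b, stdPhi ((t - μ) / σ) =
      σ * ∫ t in (a - μ) / σ..(b - μ) / σ, stdPhi t := by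
    have := intervalIntegral.integral_comp_div_sub (a := a) (b := b) stdPhi hσ.ne' (μ / σ)
    simpa only [sub_div, smul_eq_mul] using this
  simp only [truncNormalPDF, stdPhiCDF_sub]
  rw [intervalIntegral.integral_div, intervalIntegral.integral_const_mul, hsub]
  field_simp

/-- Hoeffding's covariance formula for `Cov(X, X)`, for a continuous density `f` on `[a, b]`. -/
theorem integral_integral_cdf_min_sub_mul {a b : ℝ} (h : a < b) {f F : ℝ → ℝ} (hf : Continuous f)
    (hF : ∀ t, F t = ∫ s in a..t, f s) (hb : F b = 1) :
    (∫ y in a..b, ∫ x in a..b, (F (min x y) - F x * F y)) =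
      (∫ x in a..b, x ^ 2 * f x) - (∫ x in a..b, x * f x) ^ 2 := by
  have hF' : ∀ t, HasDerivAt F (f t) t := fun t => by
    rw [funext hF]
    exact (hf.integral_hasStrictDerivAt a t).hasDerivAt
  have hFc : Continuous F := continuous_iff_continuousAt.2 fun t => (hF' t).continuousAt
  have ha : F a = 0 := by simp [hF]
  obtain ⟨G, hG⟩ : ∃ G : ℝ → ℝ, ∀ t, G t = ∫ s in a..t, F s := ⟨_, fun _ => rfl⟩
  obtain ⟨K, hK⟩ : ∃ K : ℝ → ℝ, ∀ t, K t = ∫ s in a..t, s * F s := ⟨_, fun _ => rfl⟩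
  have hG' : ∀ t, HasDerivAt G (F t) t := fun t => by
    rw [funext hG]
    exact (hFc.integral_hasStrictDerivAt a t).hasDerivAt
  have hK' : ∀ t, HasDerivAt K (t * F t) t := fun t => by
    rw [funext hK]
    exact ((continuous_id.mul hFc).integral_hasStrictDerivAt a t).hasDerivAt
  have hGc : Continuous G := continuous_iff_continuousAt.2 fun t => (hG' t).continuousAt
  have hGa : G a = 0 := by simp [hG]
  have hKa : K a = 0 := by simp [hK]
  have first_moment : ∫ x in a..b, x * f x = b - G b := by
    rw [intervalIntegral.integral_eq_sub_of_hasDerivAt (f := fun x => x * F x - G x)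
      (fun x _ => ?_) (Continuous.intervalIntegrable (by fun_prop) _ _)]
    · simp [ha, hb, hGa]
    · refine (((hasDerivAt_id' x).mul (hF' x)).sub (hG' x)).congr_deriv ?_
      ring
  have second_moment : ∫ x in a..b, x ^ 2 * f x = b ^ 2 - 2 * K b := by
    rw [intervalIntegral.integral_eq_sub_of_hasDerivAt (f := fun x => x ^ 2 * F x - 2 * K x)
      (fun x _ => ?_) (Continuous.intervalIntegrable (by fun_prop) _ _)]
    · simp [ha, hb, hKa]
    · refine (((hasDerivAt_pow 2 x).mul (hF' x)).sub ((hK' x).const_mul 2)).congr_deriv ?_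
      norm_num
      ring
  have inner : ∀ y ∈ Set.uIcc a b, ∫ x in a..b, (F (min x y) - F x * F y) =
      G y + (b - y) * F y - G b * F y := by
    intro y hy
    rw [Set.uIcc_of_le h.le] at hy
    have hmin : Continuous fun x => F (min x y) := by fun_prop
    have hleft : ∫ x in a..y, F (min x y) = G y := by
      rw [hG]
      refine intervalIntegral.integral_congr fun x hx => ?_
      rw [Set.uIcc_of_le hy.1] at hx
      simp [min_eq_left hx.2]
    have hright : ∫ x in y..b, F (min x y) = (b - y) * F y := by
      rw [← smul_eq_mul, ← intervalIntegral.integral_const]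
      refine intervalIntegral.integral_congr fun x hx => ?_
      rw [Set.uIcc_of_le hy.2] at hx
      simp [min_eq_right hx.1]
    rw [intervalIntegral.integral_sub (hmin.intervalIntegrable _ _)
      (Continuous.intervalIntegrable (by fun_prop) _ _), intervalIntegral.integral_mul_const, ← hG,
      ← intervalIntegral.integral_add_adjacent_intervals (hmin.intervalIntegrable a y)
        (hmin.intervalIntegrable y b), hleft, hright]
  rw [intervalIntegral.integral_congr inner, first_moment, second_moment,
    intervalIntegral.integral_eq_sub_of_hasDerivAt
      (f := fun y => 2 * b * G y - 2 * K y - (b - y) * G y - G b * G y)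
      (fun y _ => ?_) (Continuous.intervalIntegrable (by fun_prop) _ _)]
  · simp only [hGa, hKa]
    ring
  · refine (((((hG' y).const_mul (2 * b)).sub ((hK' y).const_mul 2)).sub
      (((hasDerivAt_id' y).const_sub b).mul (hG' y))).sub ((hG' y).const_mul (G b))).congr_deriv ?_
    ring

/-- For `X ∼ TN(μ₀,σ₀,τ_l,τ_u)` with density `f` and CDF `F(t) = ∫_{τ_l}^t f`,
`∫_{τ_l}^{τ_u} ∫_{τ_l}^{τ_u} (F(min(x,y)) − F(x)F(y)) dx dy = Var(X) = E[X²] − (E[X])²`. -/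
theorem stmt14 (μ₀ σ₀ τl τu : ℝ) (hσ : 0 < σ₀) (h : τl < τu)
    (f : ℝ → ℝ) (hf : ∀ t : ℝ, f t = truncNormalPDF μ₀ σ₀ τl τu t)
    (F : ℝ → ℝ) (hF : ∀ t : ℝ, F t = ∫ s in τl..t, f s) :
    (∫ y in τl..τu, ∫ x in τl..τu, (F (min x y) - F x * F y)) =
      (∫ x in τl..τu, x ^ 2 * f x) - (∫ x in τl..τu, x * f x) ^ 2 := by
  obtain rfl : f = truncNormalPDF μ₀ σ₀ τl τu := funext hf
  exact integral_integral_cdf_min_sub_mul h (continuous_truncNormalPDF _ _ _ _) hF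
    (by rw [hF, integral_truncNormalPDF hσ h])
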